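/- Let n > 2, k = 2^r + 1 with r ≥ 1 and r + 1 ≤ n, and s_i = k·2^{n+i} + 1. The number of pseudo-Frobenius numbers (the type) of P_k(n) equals n + r - 1. -/

import Mathlib

/-- The number of ones in the binary expansion of `t`. -/
def bitSum (t : ℕ) : ℕ := (Nat.digits 2 t).sum

@[simp] lemma bitSum_zero : bitSum 0 = 0 := by simp [bitSum]

@[simp] lemma bitSum_two_mul (t : ℕ) : bitSum (2 * t) = bitSum t := by
  rcases Nat.eq_zero_or_pos t with rfl | ht
  · simp
  · have h := Nat.digits_add_two_add_one 0 (2 * t - 1)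
    rw [show 2 * t - 1 + 1 = 2 * t by omega] at h
    simp [bitSum, h]

@[simp] lemma bitSum_two_mul_add_one (t : ℕ) : bitSum (2 * t + 1) = bitSum t + 1 := by
  have h := Nat.digits_add_two_add_one 0 (2 * t)
  rw [show (2 * t + 1) / (0 + 2) = t by omega, show (2 * t + 1) % (0 + 2) = 1 by omega] at h
  rw [bitSum, h, List.sum_cons, zero_add, bitSum, add_comm]

@[simp] lemma bitSum_one : bitSum 1 = 1 := bitSum_two_mul_add_one 0

lemma bitSum_add_le (a b : ℕ) : bitSum (a + b) ≤ bitSum a + bitSum b := by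
  induction h : a + b using Nat.strong_induction_on generalizing a b with
  | _ N ih =>
    subst h
    obtain ⟨x, rfl | rfl⟩ := Nat.even_or_odd' a <;> obtain ⟨y, rfl | rfl⟩ := Nat.even_or_odd' b
    · rcases Nat.eq_zero_or_pos (x + y) with h | h
      · obtain ⟨rfl, rfl⟩ : x = 0 ∧ y = 0 := by omega
        simp
      · have := ih (x + y) (by omega) x y rfl
        rw [← mul_add]; simpa
    · have := ih (x + y) (by omega) x y rfl
      rw [show 2 * x + (2 * y + 1) = 2 * (x + y) + 1 by ring]; simp; omega
    · have := ih (x + y) (by omega) x y rfl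
      rw [show 2 * x + 1 + 2 * y = 2 * (x + y) + 1 by ring]; simp; omega
    · have := ih (x + y) (by omega) x y rfl
      have h1 := ih (x + y + 1) (by omega) (x + y) 1 rfl
      rw [show 2 * x + 1 + (2 * y + 1) = 2 * (x + y + 1) by ring]
      simp at h1 ⊢; omega

lemma bitSum_two_pow_add (i b : ℕ) (hb : b < 2 ^ i) : bitSum (2 ^ i + b) = bitSum b + 1 := by
  induction i generalizing b with
  | zero => obtain rfl : b = 0 := by simpa using hb
            simp
  | succ i ih =>
    rw [pow_succ] at hb ⊢
    obtain ⟨y, rfl | rfl⟩ := Nat.even_or_odd' b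
    · rw [show 2 ^ i * 2 + 2 * y = 2 * (2 ^ i + y) by ring]
      simp [ih y (by omega)]
    · rw [show 2 ^ i * 2 + (2 * y + 1) = 2 * (2 ^ i + y) + 1 by ring]
      simp [ih y (by omega)]

lemma bitSum_two_pow (i : ℕ) : bitSum (2 ^ i) = 1 := by
  simpa using bitSum_two_pow_add i 0 (by positivity)

lemma bitSum_two_pow_sub_one (i : ℕ) : bitSum (2 ^ i - 1) = i := by
  induction i with
  | zero => simp
  | succ i ih =>
    have := Nat.one_le_two_pow (n := i)
    rw [show 2 ^ (i + 1) - 1 = 2 * (2 ^ i - 1) + 1 by rw [pow_succ]; omega]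
    simp [ih]

lemma bitSum_pos (t : ℕ) (ht : 0 < t) : 0 < bitSum t := by
  induction t using Nat.strong_induction_on with
  | _ t ih =>
    obtain ⟨y, rfl | rfl⟩ := Nat.even_or_odd' t
    · simpa using ih y (by omega) (by omega)
    · simp

lemma two_pow_bitSum_le (t : ℕ) : 2 ^ bitSum t ≤ t + 1 := by
  induction t using Nat.strong_induction_on with
  | _ t ih =>
    obtain ⟨y, rfl | rfl⟩ := Nat.even_or_odd' t
    · rcases Nat.eq_zero_or_pos y with rfl | h
      · simp
      · have := ih y (by omega)
        simp; omega
    · have := ih y (by omega)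
      simp [pow_succ]; omega

lemma bitSum_le (t : ℕ) : bitSum t ≤ t := by
  have := two_pow_bitSum_le t
  have := Nat.lt_two_pow_self (n := bitSum t)
  omega

/-- A number below `2 ^ N - 1` has an unset binary digit below position `N`. -/
lemma exists_bitSum_add_two_pow (N t : ℕ) (h : t + 1 < 2 ^ N) :
    ∃ p, bitSum (t + 2 ^ p) = bitSum t + 1 ∧ t + 2 ^ p < 2 ^ N := by
  induction N generalizing t with
  | zero => simp at h
  | succ N ih =>
    rw [pow_succ] at h ⊢
    obtain ⟨y, rfl | rfl⟩ := Nat.even_or_odd' t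
    · exact ⟨0, by simp, by simp; omega⟩
    · obtain ⟨p, hp, hp'⟩ := ih y (by omega)
      refine ⟨p + 1, ?_, by rw [pow_succ]; omega⟩
      rw [show 2 * y + 1 + 2 ^ (p + 1) = 2 * (y + 2 ^ p) + 1 by ring]
      simp [hp]

/-- The submonoid of `ℕ` generated by the numbers `M * 2 ^ i + 1`. -/
def shiftedPowMonoid (M : ℕ) : AddSubmonoid ℕ :=
  AddSubmonoid.closure {m | ∃ i : ℕ, m = M * 2 ^ i + 1}

lemma mul_two_pow_add_one_mem (M i : ℕ) : M * 2 ^ i + 1 ∈ shiftedPowMonoid M :=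
  AddSubmonoid.subset_closure ⟨i, rfl⟩

lemma shiftedPowMonoid_mul_two_le (M : ℕ) : shiftedPowMonoid (M * 2) ≤ shiftedPowMonoid M := by
  refine AddSubmonoid.closure_le.2 ?_
  rintro _ ⟨i, rfl⟩
  rw [mul_assoc, ← pow_succ']
  exact mul_two_pow_add_one_mem M (i + 1)

lemma mul_add_mem_of_bitSum_le (M t c : ℕ) (h1 : bitSum t ≤ c) (h2 : c ≤ t) :
    M * t + c ∈ shiftedPowMonoid M := by
  have hs0 : M + 1 ∈ shiftedPowMonoid M := by simpa using mul_two_pow_add_one_mem M 0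
  have hs1 : M * 2 + 1 ∈ shiftedPowMonoid M := by simpa using mul_two_pow_add_one_mem M 1
  induction t using Nat.strong_induction_on generalizing M c with
  | _ t ih =>
    have even_case : ∀ y c, y < t → bitSum y ≤ c → c ≤ 2 * y →
        M * (2 * y) + c ∈ shiftedPowMonoid M := by
      intro y c hy hc1 hc2
      rcases le_or_gt c y with hcy | hcy
      · rw [← mul_assoc]
        exact shiftedPowMonoid_mul_two_le M (ih y hy _ _ hc1 hcy
          (by simpa using mul_two_pow_add_one_mem (M * 2) 0)
          (by simpa using mul_two_pow_add_one_mem (M * 2) 1))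
      · obtain ⟨a, rfl⟩ := Nat.exists_eq_add_of_lt hcy
        obtain ⟨b, rfl⟩ : ∃ b, y = a + 1 + b := Nat.exists_eq_add_of_le (by omega)
        convert add_mem (nsmul_mem hs1 b) (nsmul_mem hs0 (2 * (a + 1))) using 1
        simp only [smul_eq_mul]; ring
    obtain ⟨y, rfl | rfl⟩ := Nat.even_or_odd' t
    · rcases Nat.eq_zero_or_pos y with rfl | hy
      · obtain rfl : c = 0 := by omega
        simp
      · exact even_case y c (by omega) (by simpa using h1) h2
    · obtain ⟨d, rfl⟩ : ∃ d, c = d + 1 := ⟨c - 1, by simp at h1; omega⟩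
      convert add_mem (even_case y d (by omega) (by simpa using h1) (by omega)) hs0 using 1
      ring

lemma mem_shiftedPowMonoid_iff (M x : ℕ) :
    x ∈ shiftedPowMonoid M ↔ ∃ t c, bitSum t ≤ c ∧ c ≤ t ∧ x = M * t + c := by
  refine ⟨fun h => ?_, ?_⟩
  · induction h using AddSubmonoid.closure_induction with
    | mem x hx =>
      obtain ⟨i, rfl⟩ := hx
      exact ⟨2 ^ i, 1, (bitSum_two_pow i).le, Nat.one_le_two_pow, rfl⟩
    | zero => exact ⟨0, 0, by simp⟩
    | add x y _ _ hx hy =>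
      obtain ⟨t, c, h1, h2, rfl⟩ := hx
      obtain ⟨t', c', h1', h2', rfl⟩ := hy
      exact ⟨t + t', c + c', (bitSum_add_le t t').trans (by omega), by omega, by ring⟩
  · rintro ⟨t, c, h1, h2, rfl⟩
    exact mul_add_mem_of_bitSum_le M t c h1 h2

lemma mul_add_mem_of_le (M t c : ℕ) (h1 : M ≤ c) (h2 : c ≤ t) :
    M * t + c ∈ shiftedPowMonoid M := by
  induction t using Nat.strong_induction_on generalizing c with
  | _ t ih =>
    rcases le_or_gt (bitSum t) c with h | h
    · exact mul_add_mem_of_bitSum_le M t c h h2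
    · have h3 := two_pow_bitSum_le t
      have h4 := Nat.pow_le_pow_right (n := 2) (by norm_num) h
      have h5 := Nat.lt_two_pow_self (n := c)
      rw [Nat.succ_eq_add_one, pow_succ] at h4
      obtain ⟨u, rfl⟩ : ∃ u, t = u + 1 := ⟨t - 1, by omega⟩
      convert ih u (by omega) (c + M) (by omega) (by omega) using 1
      ring

lemma mul_add_mem_iff (M : ℕ) (t c : ℤ) (h1 : t - M ≤ c) (h2 : c ≤ t) :
    (∃ y ∈ shiftedPowMonoid M, (y : ℤ) = M * t + c) ↔
      ∃ t' : ℕ, (t' : ℤ) = t ∧ (bitSum t' : ℤ) ≤ c := by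
  constructor
  · rintro ⟨y, hy, hyx⟩
    obtain ⟨u, d, hd1, hd2, rfl⟩ := (mem_shiftedPowMonoid_iff M y).1 hy
    push_cast at hyx
    obtain ⟨p, rfl⟩ : ∃ p, t = u - p := ⟨u - t, by ring⟩
    obtain rfl : c = d + M * p := by linarith
    have hp : 0 ≤ p := by
      by_contra! hp
      nlinarith
    rcases hp.eq_or_lt with rfl | hp
    · exact ⟨u, by simp, by simpa using hd1⟩
    · have hMp : (M : ℤ) ≤ M * p := le_mul_of_one_le_right (by positivity) hp
      obtain ⟨t', ht'⟩ := Int.eq_ofNat_of_zero_le (a := (u : ℤ) - p) (by omega)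
      obtain ⟨c', hc'⟩ := Int.eq_ofNat_of_zero_le (a := (d : ℤ) + M * p) (by omega)
      rw [ht', hc'] at h1 ⊢
      refine ⟨t', rfl, ?_⟩
      by_contra! hlt
      have h3 := two_pow_bitSum_le t'
      have h4 := Nat.pow_le_pow_right (n := 2) (by norm_num)
        (show c' + 1 ≤ bitSum t' by omega)
      have h5 := Nat.lt_two_pow_self (n := c')
      rw [pow_succ] at h4
      omega
  · rintro ⟨t', rfl, hc⟩
    lift c to ℕ using by omega
    exact ⟨M * t' + c, mul_add_mem_of_bitSum_le M t' c (by omega) (by omega), by push_cast; ring⟩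

/-- `x` is a pseudo-Frobenius number of the submonoid `S` of `ℕ`. -/
def IsPseudoFrobenius (S : AddSubmonoid ℕ) (x : ℤ) : Prop :=
  x ∉ (Int.ofNat '' (S : Set ℕ)) ∧
    ∀ s ∈ (Int.ofNat '' (S : Set ℕ)), s ≠ 0 → x + s ∈ (Int.ofNat '' (S : Set ℕ))

lemma isPseudoFrobenius_closure_iff (G : Set ℕ) (hG : 0 ∉ G) (x : ℤ) :
    IsPseudoFrobenius (AddSubmonoid.closure G) x ↔
      (¬ ∃ y ∈ AddSubmonoid.closure G, (y : ℤ) = x) ∧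
      ∀ g ∈ G, ∃ y ∈ AddSubmonoid.closure G, (y : ℤ) = x + g := by
  refine and_congr Iff.rfl ⟨fun h g hg => ?_, fun h => ?_⟩
  · refine h g ⟨g, AddSubmonoid.subset_closure hg, rfl⟩ ?_
    rintro h0
    exact hG (by simpa [Int.natCast_eq_zero.1 h0] using hg)
  · rintro _ ⟨s, hs, rfl⟩ hs0
    have key : s = 0 ∨ ∃ y ∈ AddSubmonoid.closure G, (y : ℤ) = x + s := by
      clear hs0
      induction hs using AddSubmonoid.closure_induction with
      | mem g hg => exact .inr (h g hg)
      | zero => exact .inl rfl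
      | add a b ha hb iha ihb =>
        rcases iha with rfl | ⟨y, hy, hyx⟩
        · simpa using ihb
        · exact .inr ⟨y + b, add_mem hy hb, by push_cast; rw [hyx]; ring⟩
    exact key.resolve_left (by rintro rfl; exact hs0 rfl)

/-- The pairs `(t, c)` for which `M * t + c` is a pseudo-Frobenius number. -/
def IsPFPair (M t c : ℕ) : Prop :=
  c < bitSum t ∧ t ≤ M + c ∧ ∀ i, t + 2 ^ i ≤ M + c + 1 → bitSum (t + 2 ^ i) ≤ c + 1

lemma isPseudoFrobenius_shiftedPowMonoid_iff (M : ℕ) (hM : 1 ≤ M) (x : ℤ) :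
    IsPseudoFrobenius (shiftedPowMonoid M) x ↔
      ∃ t c : ℕ, IsPFPair M t c ∧ x = M * t + c := by
  rw [shiftedPowMonoid, isPseudoFrobenius_closure_iff _ (by rintro ⟨i, hi⟩; omega),
    ← shiftedPowMonoid]
  simp only [Set.mem_ofPred_eq, forall_exists_index, forall_eq_apply_imp_iff]
  constructor
  · rintro ⟨hx, hg⟩
    obtain ⟨t, c, h1, h2, rfl⟩ : ∃ t c : ℤ, t - M ≤ c ∧ c ≤ t ∧ x = M * t + c := by
      have e1 := Int.emod_add_mul_ediv (-x) (M + 1)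
      have e2 := Int.emod_nonneg (-x) (b := M + 1) (by omega)
      have e3 := Int.emod_lt_of_pos (-x) (b := M + 1) (by omega)
      set j := -x % (M + 1)
      set q := -x / ((M : ℤ) + 1)
      exact ⟨-q, -q - j, by linarith, by linarith, by linarith⟩
    have step : ∀ i : ℕ, t + 2 ^ i ≤ M + c + 1 →
        ∃ t' : ℕ, (t' : ℤ) = t + 2 ^ i ∧ (bitSum t' : ℤ) ≤ c + 1 := by
      intro i hi
      have hi1 : (1 : ℤ) ≤ 2 ^ i := one_le_pow₀ (by norm_num)
      refine (mul_add_mem_iff M (t + 2 ^ i) (c + 1) (by linarith) (by linarith)).1 ?_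
      obtain ⟨y, hy, hyx⟩ := hg i
      exact ⟨y, hy, by rw [hyx]; push_cast; ring⟩
    rw [mul_add_mem_iff M t c h1 h2] at hx
    obtain ⟨t', ht', hc'⟩ := step 0 (by rw [pow_zero]; linarith)
    rw [pow_zero] at ht'
    have ht0 : 0 ≤ t := by
      by_contra! ht
      obtain rfl : t = -1 := by omega
      obtain rfl : t' = 0 := by omega
      obtain rfl : c = -1 := by simp at hc'; omega
      obtain ⟨u, hu, hu'⟩ := step 1 (by norm_num; omega)
      obtain rfl : u = 1 := by omega
      simp at hu'
    lift t to ℕ using ht0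
    obtain rfl : t' = t + 1 := by omega
    have hc0 : 0 ≤ c := by
      have := bitSum_pos (t + 1) (by omega)
      omega
    lift c to ℕ using hc0
    refine ⟨t, c, ⟨?_, by omega, fun i hi => ?_⟩, rfl⟩
    · by_contra! h
      exact hx ⟨t, rfl, by exact_mod_cast h⟩
    · obtain ⟨u, hu, hu'⟩ := step i (by exact_mod_cast hi)
      obtain rfl : u = t + 2 ^ i := by exact_mod_cast hu
      exact_mod_cast hu'
  · rintro ⟨t, c, ⟨hc, htc, hi⟩, rfl⟩
    have hct : c ≤ t := hc.le.trans (bitSum_le t)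
    refine ⟨?_, ?_⟩
    · rw [mul_add_mem_iff M t c (by omega) (by omega)]
      rintro ⟨t', ht', h⟩
      obtain rfl : t' = t := by exact_mod_cast ht'
      omega
    · intro i
      rcases le_or_gt (t + 2 ^ i) (M + c + 1) with h | h
      · refine ⟨_, mul_add_mem_of_bitSum_le M (t + 2 ^ i) (c + 1) (hi i h) ?_, ?_⟩
        · have := Nat.one_le_two_pow (n := i)
          omega
        · push_cast; ring
      · obtain ⟨u, hu⟩ : ∃ u, t + 2 ^ i = u + 1 := ⟨t + 2 ^ i - 1, by omega⟩
        refine ⟨_, mul_add_mem_of_le M u (c + 1 + M) (by omega) (by omega), ?_⟩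
        have hu' : (t : ℤ) + 2 ^ i = u + 1 := by exact_mod_cast hu
        push_cast
        linear_combination (-(M : ℤ)) * hu'

lemma bitSum_two_pow_add_two_pow_add (n r b : ℕ) (hr : 1 ≤ r) (hb : b < 2 ^ n) :
    bitSum (2 ^ (n + r) + 2 ^ n + b) = bitSum b + 2 := by
  have : 2 ^ n * 2 ≤ 2 ^ (n + r) := by
    rw [← pow_succ]; exact Nat.pow_le_pow_right (by norm_num) (by omega)
  rw [add_assoc, bitSum_two_pow_add _ _ (by omega), bitSum_two_pow_add _ _ hb]

lemma isPFPair_iff (n r : ℕ) (hn : 2 < n) (hr : 1 ≤ r) (hrn : r + 1 ≤ n) (t c : ℕ) :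
    IsPFPair (2 ^ (n + r) + 2 ^ n) t c ↔
      (t = 2 ^ (n + r) - 1 ∧ n ≤ c ∧ c < n + r) ∨
      (t = 2 ^ (n + r) + 2 ^ n - 1 ∧ 3 ≤ c ∧ c ≤ n) ∨
      (t = 2 ^ (n + r) + 2 ^ n + 3 ∧ c = 3) := by
  have h8 : 2 ^ 3 ≤ 2 ^ n := Nat.pow_le_pow_right (by norm_num) hn
  have hnr : 2 ^ n * 2 ≤ 2 ^ (n + r) := by
    rw [← pow_succ]; exact Nat.pow_le_pow_right (by norm_num) (by omega)
  have h2n : 2 * n + 2 ≤ 2 ^ n := by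
    clear hrn hnr h8
    induction n, hn using Nat.le_induction with
    | base => norm_num
    | succ n _ ih => rw [pow_succ]; omega
  have b2 : bitSum 2 = 1 := by simpa using bitSum_two_mul 1
  have b3 : bitSum 3 = 2 := by simpa using bitSum_two_mul_add_one 1
  have b4 : bitSum 4 = 1 := by simpa [b2] using bitSum_two_mul 2
  have hM := fun b => bitSum_two_pow_add_two_pow_add n r b hr
  have hM0 := hM 0 (by omega)
  have hM1 := hM 1 (by omega)
  have hM2 := hM 2 (by omega)
  have hM3 := hM 3 (by omega)
  have hM4 := hM 4 (by omega)
  have hMn := bitSum_two_pow_add (n + r) (2 ^ n - 1) (by omega)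
  rw [← Nat.add_sub_assoc (by omega)] at hMn
  simp only [bitSum_two_pow_sub_one, bitSum_zero, bitSum_one, b2, b3, b4, zero_add,
    add_zero, Nat.reduceAdd] at hM0 hM1 hM2 hM3 hM4 hMn
  set A := 2 ^ (n + r) with hA
  set M := A + 2 ^ n with hMdef
  constructor
  · rintro ⟨hc, htc, hi⟩
    rcases lt_trichotomy (t + 1) A with h | h | h
    · obtain ⟨p, hp, hp'⟩ := exists_bitSum_add_two_pow (n + r) t h
      have := hi p (by omega)
      omega
    · left
      obtain rfl : t = A - 1 := by omega
      rw [bitSum_two_pow_sub_one] at hc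
      have h1 := hi n (by omega)
      rw [show A - 1 + 2 ^ n = A + (2 ^ n - 1) by omega, bitSum_two_pow_add _ _ (by omega),
        bitSum_two_pow_sub_one] at h1
      omega
    rcases lt_trichotomy (t + 1) M with h' | h' | h'
    · obtain ⟨u, rfl⟩ : ∃ u, t = A + u := Nat.exists_eq_add_of_le (by omega)
      obtain ⟨p, hp, hp'⟩ := exists_bitSum_add_two_pow n u (by omega)
      have := hi p (by omega)
      rw [add_assoc, bitSum_two_pow_add _ _ (by omega)] at this
      rw [bitSum_two_pow_add _ _ (by omega)] at hc
      omega
    · right; left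
      obtain rfl : t = M - 1 := by omega
      have h1 := hi 1 (by omega)
      rw [show M - 1 + 2 ^ 1 = M + 1 by omega, hM1] at h1
      have h2 := hi 2 (by omega)
      rw [show M - 1 + 2 ^ 2 = M + 3 by omega, hM3] at h2
      omega
    · right; right
      obtain ⟨u, rfl⟩ : ∃ u, t = M + u := Nat.exists_eq_add_of_le (by omega)
      have hw : bitSum (M + u) ≤ 2 + bitSum u := by
        simpa [hM0] using bitSum_add_le M u
      have h2 := two_pow_bitSum_le u
      have hw2 : bitSum u ≤ 2 := by
        by_contra! h3
        have : ∀ w, 3 ≤ w → w + 3 ≤ 2 ^ w := by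
          intro w hw
          induction w, hw using Nat.le_induction with
          | base => norm_num
          | succ w _ ih => rw [pow_succ]; omega
        have := this _ h3
        omega
      have hu : u ≤ 3 := by omega
      have hi0 := hi 0
      have hi1 := hi 1
      rw [pow_zero] at hi0
      rw [pow_one] at hi1
      interval_cases u <;> simp only [add_assoc, Nat.reduceAdd, add_zero] at hc hi0 hi1 <;>
        omega
  · rintro (⟨rfl, h1, h2⟩ | ⟨rfl, h1, h2⟩ | ⟨rfl, rfl⟩)
    · refine ⟨by rwa [bitSum_two_pow_sub_one], by omega, fun i hi => ?_⟩
      have hin : i < n + 1 := by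
        rw [← Nat.pow_lt_pow_iff_right (a := 2) (by norm_num), pow_succ]; omega
      have := Nat.pow_le_pow_right (n := 2) (by norm_num) (Nat.le_of_lt_succ hin)
      have := Nat.one_le_two_pow (n := i)
      rw [show A - 1 + 2 ^ i = A + (2 ^ i - 1) by omega, bitSum_two_pow_add _ _ (by omega),
        bitSum_two_pow_sub_one]
      omega
    · refine ⟨by omega, by omega, fun i hi => ?_⟩
      have hc : c + 3 ≤ 2 ^ c := by
        clear hi h2
        induction c, h1 using Nat.le_induction with
        | base => norm_num
        | succ c _ ih => rw [pow_succ]; omega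
      have hic : i < c := by
        rw [← Nat.pow_lt_pow_iff_right (a := 2) (by norm_num)]; omega
      have := Nat.one_le_two_pow (n := i)
      rw [show M - 1 + 2 ^ i = M + (2 ^ i - 1) by omega, hM _ (by omega),
        bitSum_two_pow_sub_one]
      omega
    · refine ⟨by omega, by omega, fun i hi => ?_⟩
      have := Nat.one_le_two_pow (n := i)
      rw [show M + 3 + 2 ^ i = M + 4 by omega]
      omega

theorem proth_type (n r : ℕ) (hn : 2 < n) (hr : 1 ≤ r) (hrn : r + 1 ≤ n) :
    Nat.card {x : ℤ |
        x ∉ (Int.ofNat '' (AddSubmonoid.closure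
          {m : ℕ | ∃ i : ℕ, m = (2 ^ r + 1) * 2 ^ (n + i) + 1} : Set ℕ)) ∧
        ∀ s ∈ (Int.ofNat '' (AddSubmonoid.closure
          {m : ℕ | ∃ i : ℕ, m = (2 ^ r + 1) * 2 ^ (n + i) + 1} : Set ℕ)),
          s ≠ 0 → x + s ∈ (Int.ofNat '' (AddSubmonoid.closure
            {m : ℕ | ∃ i : ℕ, m = (2 ^ r + 1) * 2 ^ (n + i) + 1} : Set ℕ))} =
      n + r - 1 := by
  have hS : AddSubmonoid.closure {m : ℕ | ∃ i : ℕ, m = (2 ^ r + 1) * 2 ^ (n + i) + 1} =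
      shiftedPowMonoid (2 ^ (n + r) + 2 ^ n) := by
    have (i : ℕ) : (2 ^ r + 1) * 2 ^ (n + i) = (2 ^ (n + r) + 2 ^ n) * 2 ^ i := by ring
    simp only [shiftedPowMonoid, this]
  rw [hS]
  change Nat.card {x : ℤ | IsPseudoFrobenius _ x} = _
  have hn1 : n < 2 ^ n := Nat.lt_two_pow_self
  have hnr : n + r < 2 ^ (n + r) := Nat.lt_two_pow_self
  simp only [isPseudoFrobenius_shiftedPowMonoid_iff (2 ^ (n + r) + 2 ^ n) (by omega),
    isPFPair_iff n r hn hr hrn]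
  set A := 2 ^ (n + r)
  set M := A + 2 ^ n with hM
  let F : Finset (ℕ × ℕ) :=
    ({A - 1} ×ˢ Finset.Ico n (n + r) ∪ {M - 1} ×ˢ Finset.Icc 3 n) ∪ {(M + 3, 3)}
  have hF : ∀ p ∈ F, p.2 < M := by
    rintro ⟨t, c⟩ hp
    simp only [F, Finset.mem_union, Finset.mem_product, Finset.mem_singleton, Finset.mem_Ico,
      Finset.mem_Icc, Prod.mk.injEq] at hp
    dsimp only
    omega
  have himage : {x : ℤ | ∃ t c : ℕ, ((t = A - 1 ∧ n ≤ c ∧ c < n + r) ∨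
      (t = M - 1 ∧ 3 ≤ c ∧ c ≤ n) ∨ (t = M + 3 ∧ c = 3)) ∧ x = (M : ℕ) * t + c} =
      (fun p : ℕ × ℕ => ((M * p.1 + p.2 : ℕ) : ℤ)) '' F := by
    ext x
    simp only [F, Set.mem_ofPred_eq, Set.mem_image, Finset.mem_coe, Prod.exists, Finset.mem_union,
      Finset.mem_product, Finset.mem_singleton, Finset.mem_Ico, Finset.mem_Icc, Prod.mk.injEq,
      or_assoc, Nat.cast_add, Nat.cast_mul, eq_comm (a := x)]
  have hinj : Set.InjOn (fun p : ℕ × ℕ => ((M * p.1 + p.2 : ℕ) : ℤ)) F := by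
    rintro ⟨t, c⟩ hp ⟨t', c'⟩ hp' h
    have h1 := hF _ hp
    have h2 := hF _ hp'
    have h3 : M * t + c = M * t' + c' := Int.natCast_inj.1 h
    have hdiv := congrArg (· / M) h3
    have hmod := congrArg (· % M) h3
    simp only [Nat.mul_add_div (show 0 < M by omega), Nat.mul_add_mod, Nat.div_eq_of_lt h1,
      Nat.div_eq_of_lt h2, Nat.mod_eq_of_lt h1, Nat.mod_eq_of_lt h2, add_zero] at hdiv hmod
    rw [hdiv, hmod]
  rw [himage, Nat.card_coe_set_eq, hinj.ncard_image, Set.ncard_coe_finset,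
    Finset.card_union_of_disjoint, Finset.card_union_of_disjoint]
  · simp; omega
  · simp only [Finset.disjoint_left, Finset.mem_product, Finset.mem_singleton]
    omega
  · simp only [Finset.disjoint_left, Finset.mem_union, Finset.mem_product, Finset.mem_singleton]
    rintro ⟨t, c⟩ h heq
    simp only [Prod.mk.injEq] at heq
    omega
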